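/- arXiv:2201.06609 — 8 statements merged into one kernel-verified Lean document; each statement's English description precedes it below -/
import Mathlib

section
/- Suppose there exists an (n^(1)_1,…,n^(1)_{L₁}; k) point-to-point L₁-links code achieving delay spectrum T^(1) = (T^(1)[1],…,T^(1)[k]) under (N^(1)_1,…,N^(1)_{L₁}) erasures, and an (n^(2)_1,…,n^(2)_{L₂}; k) point-to-point L₂-links code achieving delay spectrum T^(2) = (T^(2)[1],…,T^(2)[k]) under (N^(2)_1,…,N^(2)_{L₂}) erasures. Then for every permutation π of {1,…,k} there exists a streaming code for the three-node relay network with first-hop channel-packet lengths n^(1), second-hop channel-packet lengths n^(2) and source-packet length k, which achieves the delay spectrum T with T[j] = T^(1)[j] + T^(2)[π(j)] under N^(1) erasures on the first-hop links and N^(2) erasures on the second-hop links; i.e., for every admissible choice of erasure sequences, every time t and every j ∈ {1,…,k}, the destination computes s_t[j] from its received channel outputs up to time t + T^(1)[j] + T^(2)[π(j)]. -/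
open scoped BigOperators

/-- Output of an erasure link whose (finite) set of erased time slots is `E`:
at time `t` the receiver obtains the channel packet `x t` if `t ∉ E`,
and the erasure symbol `*` (modelled by `none`) otherwise. -/
def linkOut {α : Type*} (E : Finset ℕ) (x : ℕ → α) (t : ℕ) : Option α :=
  if t ∈ E then none else some (x t)

/-- An `(n₁,…,n_L; k)` point-to-point `L`-links code over the alphabet `F`:
at each time `t` and on each link `i`, an encoder maps the source packets
`s₀, …, s_t ∈ F^k` to a channel packet in `F^(n i)`. -/
structure PtPCode (F : Type) (L k : ℕ) (n : Fin L → ℕ) where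
  enc : (t : ℕ) → (i : Fin L) → (Fin (t + 1) → (Fin k → F)) → (Fin (n i) → F)

namespace PtPCode

variable {F : Type} {L k : ℕ} {n : Fin L → ℕ}

/-- Channel packet transmitted on link `i` at time `t` for the source sequence `s`. -/
def x (c : PtPCode F L k n) (s : ℕ → Fin k → F) (t : ℕ) (i : Fin L) : Fin (n i) → F :=
  c.enc t i (fun u => s u)

/-- The code achieves delay spectrum `T` under `(N₁,…,N_L)` erasures: there are decoders
such that, for every choice of an `N i`-erasure sequence on each link `i`, every time `t`
and every `j`, the symbol `s t j` is computed exactly from the link outputs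
`{y (t', i) : t' ≤ t + T j, i ∈ Fin L}`. -/
def Achieves (c : PtPCode F L k n) (N : Fin L → ℕ) (T : Fin k → ℕ) : Prop :=
  ∃ dec : (t : ℕ) → (j : Fin k) →
      ((t' : Fin (t + T j + 1)) → (i : Fin L) → Option (Fin (n i) → F)) → F,
    ∀ (s : ℕ → Fin k → F) (E : Fin L → Finset ℕ),
      (∀ i, (E i).card = N i) →
      ∀ (t : ℕ) (j : Fin k),
        dec t j (fun t' i => linkOut (E i) (fun u => c.x s u i) t') = s t j

end PtPCode

/-- A streaming code for the three-node relay network with `L1` source–relay links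
(channel-packet lengths `n1`) and `L2` relay–destination links (channel-packet
lengths `n2`), and source packets in `F^k`.  The relay encoder of each
relay–destination link sees all first-hop channel outputs received up to time `t`. -/
structure RelayCode (F : Type) (L1 L2 k : ℕ) (n1 : Fin L1 → ℕ) (n2 : Fin L2 → ℕ) where
  srcEnc : (t : ℕ) → (i : Fin L1) → (Fin (t + 1) → (Fin k → F)) → (Fin (n1 i) → F)
  relEnc : (t : ℕ) → (i : Fin L2) →
    ((t' : Fin (t + 1)) → (j : Fin L1) → Option (Fin (n1 j) → F)) → (Fin (n2 i) → F)

namespace RelayCode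

variable {F : Type} {L1 L2 k : ℕ} {n1 : Fin L1 → ℕ} {n2 : Fin L2 → ℕ}

/-- First-hop channel packets. -/
def x1 (c : RelayCode F L1 L2 k n1 n2) (s : ℕ → Fin k → F) (t : ℕ) (i : Fin L1) :
    Fin (n1 i) → F :=
  c.srcEnc t i (fun u => s u)

/-- Second-hop channel packets, given the first-hop erasure patterns `E1`. -/
def x2 (c : RelayCode F L1 L2 k n1 n2) (s : ℕ → Fin k → F) (E1 : Fin L1 → Finset ℕ)
    (t : ℕ) (i : Fin L2) : Fin (n2 i) → F :=
  c.relEnc t i (fun t' j => linkOut (E1 j) (fun v => c.x1 s v j) t')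

/-- The streaming code achieves delay spectrum `T` under `N1` erasures on the first-hop
links and `N2` erasures on the second-hop links: for every admissible choice of erasure
sequences, every time `t` and every `j`, the destination computes `s t j` from its
received second-hop channel outputs up to time `t + T j`. -/
def AchievesSpectrum (c : RelayCode F L1 L2 k n1 n2) (N1 : Fin L1 → ℕ) (N2 : Fin L2 → ℕ)
    (T : Fin k → ℕ) : Prop :=
  ∃ dec : (t : ℕ) → (j : Fin k) →
      ((t' : Fin (t + T j + 1)) → (i : Fin L2) → Option (Fin (n2 i) → F)) → F,
    ∀ (s : ℕ → Fin k → F) (E1 : Fin L1 → Finset ℕ) (E2 : Fin L2 → Finset ℕ),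
      (∀ i, (E1 i).card = N1 i) → (∀ i, (E2 i).card = N2 i) →
      ∀ (t : ℕ) (j : Fin k),
        dec t j (fun t' i => linkOut (E2 i) (fun u => c.x2 s E1 u i) t') = s t j

/-- The streaming code is `(N1, N2)`-achievable with decoding deadline `T`: for every
source sequence and every admissible choice of erasure sequences, the destination's
estimate at time `t + T` (computed from all second-hop outputs up to time `t + T`)
equals `s t`. -/
def Achievable (c : RelayCode F L1 L2 k n1 n2) (N1 : Fin L1 → ℕ) (N2 : Fin L2 → ℕ)
    (T : ℕ) : Prop :=
  ∃ dec : (t : ℕ) →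
      ((t' : Fin (t + T + 1)) → (i : Fin L2) → Option (Fin (n2 i) → F)) → (Fin k → F),
    ∀ (s : ℕ → Fin k → F) (E1 : Fin L1 → Finset ℕ) (E2 : Fin L2 → Finset ℕ),
      (∀ i, (E1 i).card = N1 i) → (∀ i, (E2 i).card = N2 i) →
      ∀ t : ℕ, dec t (fun t' i => linkOut (E2 i) (fun u => c.x2 s E1 u i) t') = s t

end RelayCode

namespace PtPCode

variable {F : Type} {L k : ℕ} {n : Fin L → ℕ}

/-- The decoders of a point-to-point code with `k` symbols and delay spectrum `T`. -/
abbrev Decoder (F : Type) (L k : ℕ) (n : Fin L → ℕ) (T : Fin k → ℕ) : Type :=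
  (t : ℕ) → (j : Fin k) →
    ((t' : Fin (t + T j + 1)) → (i : Fin L) → Option (Fin (n i) → F)) → F

/-- The packet a relay forms at time `u` from the link outputs up to time `t ≥ u`:
its symbol `π j` is the estimate of the source symbol `j` of time `u - T j`, or `0` if
`u < T j`. -/
def Decoder.relayPacket [Zero F] {T : Fin k → ℕ} (dec : Decoder F L k n T)
    (π : Equiv.Perm (Fin k)) {t : ℕ}
    (y : (t' : Fin (t + 1)) → (i : Fin L) → Option (Fin (n i) → F))
    (u : Fin (t + 1)) (m : Fin k) : F :=
  if h : T (π.symm m) ≤ u then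
    dec (u - T (π.symm m)) (π.symm m) fun t' => y ⟨t', by omega⟩
  else 0

/-- The source sequence in which symbol `j` is delayed by `T j` and moved to position `π j`. -/
def delayed [Zero F] (T : Fin k → ℕ) (π : Equiv.Perm (Fin k)) (s : ℕ → Fin k → F)
    (u : ℕ) (m : Fin k) : F :=
  if T (π.symm m) ≤ u then s (u - T (π.symm m)) (π.symm m) else 0

theorem delayed_add_apply [Zero F] (T : Fin k → ℕ) (π : Equiv.Perm (Fin k))
    (s : ℕ → Fin k → F) (t : ℕ) (j : Fin k) :
    delayed T π s (t + T j) (π j) = s t j := by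
  simp [delayed]

end PtPCode

open PtPCode in
/-- Symbol-wise decode-and-forward: the relay re-encodes with `c2` the symbols that it
decodes from `c1`. -/
def RelayCode.decodeForward {F : Type} [Zero F] {L1 L2 k : ℕ} {n1 : Fin L1 → ℕ}
    {n2 : Fin L2 → ℕ} {T : Fin k → ℕ} (c1 : PtPCode F L1 k n1) (dec : Decoder F L1 k n1 T)
    (c2 : PtPCode F L2 k n2) (π : Equiv.Perm (Fin k)) : RelayCode F L1 L2 k n1 n2 where
  srcEnc := c1.enc
  relEnc t i y := c2.enc t i (dec.relayPacket π y)

/-- If there is an `(n1; k)` point-to-point `L1`-links code achieving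
delay spectrum `T1` under `N1` erasures, and an `(n2; k)` point-to-point `L2`-links code
achieving delay spectrum `T2` under `N2` erasures, then for every permutation `π` of the
`k` symbols there is a streaming code for the three-node relay network achieving the
delay spectrum `j ↦ T1 j + T2 (π j)` under `N1` erasures on the first-hop links and
`N2` erasures on the second-hop links. -/
theorem stmt0 (F : Type) [Field F] [Fintype F] (L1 L2 k : ℕ)
    (n1 N1 : Fin L1 → ℕ) (n2 N2 : Fin L2 → ℕ) (T1 T2 : Fin k → ℕ)
    (h1 : ∃ c : PtPCode F L1 k n1, c.Achieves N1 T1)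
    (h2 : ∃ c : PtPCode F L2 k n2, c.Achieves N2 T2)
    (π : Equiv.Perm (Fin k)) :
    ∃ c : RelayCode F L1 L2 k n1 n2,
      c.AchievesSpectrum N1 N2 (fun j => T1 j + T2 (π j)) := by
  obtain ⟨c1, dec1, hdec1⟩ := h1
  obtain ⟨c2, dec2, hdec2⟩ := h2
  refine ⟨RelayCode.decodeForward c1 dec1 c2 π, fun t j y =>
    dec2 (t + T1 j) (π j) fun t' => y ⟨t', by dsimp only; omega⟩, ?_⟩
  intro s E1 E2 hE1 hE2 t j
  have hx2 (u : ℕ) (i : Fin L2) :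
      (RelayCode.decodeForward c1 dec1 c2 π).x2 s E1 u i =
        c2.x (PtPCode.delayed T1 π s) u i := by
    refine congrArg (c2.enc u i) ?_
    funext v m
    unfold PtPCode.Decoder.relayPacket PtPCode.delayed
    split_ifs
    · exact hdec1 s E1 hE1 _ _
    · rfl
  simp only [hx2]
  exact (hdec2 _ E2 hE2 _ _).trans (PtPCode.delayed_add_apply T1 π s t j)
end

section
/- For all integers N ≥ 1 and k ≥ 1 there exists a finite field 𝔽 (any sufficiently large finite field suffices) over which there is a systematic (N+k; k) point-to-point single-link code achieving the delay spectrum (N, N+1, …, N+k−1) under N erasures; that is, for every N-erasure sequence, the j-th symbol of each source packet s_t is recoverable from the non-erased channel packets received by time t + N + (k − j) when symbols are ordered so that the j-th symbol has delay N + k − j. -/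
open scoped BigOperators

/-- An `(n; k)` point-to-point single-link code over the alphabet `F`:
at each time `t`, an encoder maps the source packets `s₀, …, s_t ∈ F^k`
to a channel packet in `F^n`. -/
structure SLCode (F : Type) (n k : ℕ) where
  enc : (t : ℕ) → (Fin (t + 1) → (Fin k → F)) → (Fin n → F)

namespace SLCode

variable {F : Type} {n k : ℕ}

/-- Channel packet transmitted at time `t` for the source sequence `s`. -/
def x (c : SLCode F n k) (s : ℕ → Fin k → F) (t : ℕ) : Fin n → F :=
  c.enc t (fun u => s u)

/-- The code achieves delay spectrum `T` under `N` erasures: there are decoders such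
that, for every `N`-erasure sequence, every time `t` and every `j`, the symbol `s t j`
is computed exactly from the link outputs `{y t' : t' ≤ t + T j}`. -/
def Achieves (c : SLCode F n k) (N : ℕ) (T : Fin k → ℕ) : Prop :=
  ∃ dec : (t : ℕ) → (j : Fin k) → (Fin (t + T j + 1) → Option (Fin n → F)) → F,
    ∀ (s : ℕ → Fin k → F) (E : Finset ℕ), E.card = N →
      ∀ (t : ℕ) (j : Fin k),
        dec t j (fun t' => linkOut E (fun u => c.x s u) t') = s t j

/-- The code is systematic: the first `k` symbols of each channel packet are the
corresponding source symbols. -/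
def Systematic (c : SLCode F n k) (h : k ≤ n) : Prop :=
  ∀ (s : ℕ → Fin k → F) (t : ℕ) (j : Fin k), c.x s t (Fin.castLE h j) = s t j

end SLCode

section DiagonalCode

variable {F : Type} [Field F] {N k : ℕ}

/-- The message carried by the diagonal starting at time `d`: its `l`-th symbol is the `l`-th
symbol of the source packet sent at time `d + l`, or `0` if that time is negative. -/
def diagMessage (s : ℕ → Fin k → F) (d : ℤ) (l : Fin k) : F :=
  if 0 ≤ d + (l : ℕ) then s (d + (l : ℕ)).toNat l else 0

/-- The polynomial of degree less than `k` taking the value `diagMessage s d l` at each node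
`l < k`; its values at `0, 1, …, N + k - 1` form the codeword of the diagonal `d`. -/
noncomputable def diagPoly (s : ℕ → Fin k → F) (d : ℤ) : Polynomial F :=
  Lagrange.interpolate Finset.univ (fun l : Fin k => ((l : ℕ) : F)) (diagMessage s d)

/-- The diagonally interleaved systematic Reed–Solomon code with nodes `0, 1, …, N + k - 1`. -/
noncomputable def diagCode (F : Type) [Field F] (N k : ℕ) : SLCode F (N + k) k where
  enc t u i :=
    (diagPoly (fun τ => if h : τ < t + 1 then u ⟨τ, h⟩ else 0) ((t : ℤ) - (i : ℕ))).eval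
      ((i : ℕ) : F)

lemma injOn_fin_natCast (hF : Set.InjOn (Nat.cast : ℕ → F) (Set.Iio (N + k))) :
    Set.InjOn (fun l : Fin k => ((l : ℕ) : F)) (Finset.univ : Finset (Fin k)) :=
  fun a _ b _ hab => Fin.ext <|
    hF (Set.mem_Iio.2 (by omega)) (Set.mem_Iio.2 (by omega)) hab

lemma eval_diagPoly (hF : Set.InjOn (Nat.cast : ℕ → F) (Set.Iio (N + k)))
    (s : ℕ → Fin k → F) (d : ℤ) (l : Fin k) :
    (diagPoly s d).eval ((l : ℕ) : F) = diagMessage s d l :=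
  Lagrange.eval_interpolate_at_node _ (injOn_fin_natCast hF) (Finset.mem_univ l)

lemma degree_diagPoly_lt (hF : Set.InjOn (Nat.cast : ℕ → F) (Set.Iio (N + k)))
    (s : ℕ → Fin k → F) (d : ℤ) : (diagPoly s d).degree < k :=
  (Lagrange.degree_interpolate_lt (diagMessage s d) (injOn_fin_natCast hF)).trans_eq <| by
    rw [Finset.card_univ, Fintype.card_fin]

lemma diagMessage_sub_self (s : ℕ → Fin k → F) (t : ℕ) (l : Fin k) :
    diagMessage s ((t : ℤ) - (l : ℕ)) l = s t l := by
  simp [diagMessage]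

lemma diagCode_x (hF : Set.InjOn (Nat.cast : ℕ → F) (Set.Iio (N + k)))
    (s : ℕ → Fin k → F) (t : ℕ) (i : Fin (N + k)) :
    (diagCode F N k).x s t i = (diagPoly s ((t : ℤ) - (i : ℕ))).eval ((i : ℕ) : F) := by
  simp only [SLCode.x, diagCode]
  by_cases hi : (i : ℕ) < k
  · have h := fun s' : ℕ → Fin k → F =>
      (eval_diagPoly hF s' ((t : ℤ) - (i : ℕ)) ⟨i, hi⟩).trans (diagMessage_sub_self s' t ⟨i, hi⟩)
    simp only at h
    rw [h, h]
    simp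
  · congr 1
    unfold diagPoly
    congr 1
    funext l
    have hl := l.isLt
    unfold diagMessage
    split_ifs with h0
    · exact congrFun (dif_pos (by omega)) l
    · rfl

lemma diagCode_systematic (hF : Set.InjOn (Nat.cast : ℕ → F) (Set.Iio (N + k)))
    (h : k ≤ N + k) : (diagCode F N k).Systematic h := by
  intro s t j
  rw [diagCode_x hF, Fin.val_castLE, eval_diagPoly hF, diagMessage_sub_self]

/-- Codewords of a diagonal that agree outside at most `N` positions coincide. -/
lemma diagPoly_eq_of_eval_eq (hF : Set.InjOn (Nat.cast : ℕ → F) (Set.Iio (N + k)))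
    (s s' : ℕ → Fin k → F) (d : ℤ) (B : Finset ℕ) (hB : B.card ≤ N)
    (h : ∀ i < N + k, i ∉ B → (diagPoly s d).eval (i : F) = (diagPoly s' d).eval (i : F)) :
    diagPoly s d = diagPoly s' d := by
  have hcard : k ≤ (Finset.range (N + k) \ B).card := by
    have := Finset.le_card_sdiff B (Finset.range (N + k))
    rw [Finset.card_range] at this
    omega
  have hcard' : (k : WithBot ℕ) ≤ ((Finset.range (N + k) \ B).card : ℕ) := by
    exact_mod_cast hcard
  refine Polynomial.eq_of_degrees_lt_of_eval_index_eq (v := (Nat.cast : ℕ → F))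
    (Finset.range (N + k) \ B) (hF.mono fun i hi => ?_)
    ((degree_diagPoly_lt hF s d).trans_le hcard') ((degree_diagPoly_lt hF s' d).trans_le hcard')
    fun i hi => ?_
  · simp only [Finset.coe_sdiff, Finset.coe_range] at hi
    exact hi.1
  · rw [Finset.mem_sdiff, Finset.mem_range] at hi
    exact h i hi.1 hi.2

lemma eq_of_linkOut_eq {α : Type*} {E E' : Finset ℕ} {x x' : ℕ → α} {t : ℕ}
    (h : linkOut E x t = linkOut E' x' t) (ht : t ∉ E) : x t = x' t := by
  unfold linkOut at h
  split_ifs at h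
  exact Option.some.inj h

lemma diagCode_recover (hF : Set.InjOn (Nat.cast : ℕ → F) (Set.Iio (N + k)))
    {s s' : ℕ → Fin k → F} {E E' : Finset ℕ} (hE : E.card ≤ N) {t : ℕ} {j : Fin k}
    (h : ∀ τ ≤ t + (N + (k - 1 - (j : ℕ))),
      linkOut E ((diagCode F N k).x s) τ = linkOut E' ((diagCode F N k).x s') τ) :
    s t j = s' t j := by
  have hj := j.isLt
  set d : ℤ := (t : ℤ) - (j : ℕ) with hd
  let B : Finset ℕ := (E.filter fun τ : ℕ => 0 ≤ (τ : ℤ) - d).image fun τ : ℕ => ((τ : ℤ) - d).toNat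
  have hB : B.card ≤ N :=
    Finset.card_image_le.trans ((Finset.card_filter_le _ _).trans hE)
  have hP : diagPoly s d = diagPoly s' d := by
    refine diagPoly_eq_of_eval_eq hF s s' d B hB fun i hi hiB => ?_
    by_cases h0 : 0 ≤ d + i
    · obtain ⟨τ, hτ⟩ := Int.eq_ofNat_of_zero_le h0
      have hτE : τ ∉ E := fun hmem => hiB <| Finset.mem_image.2
        ⟨τ, Finset.mem_filter.2 ⟨hmem, by omega⟩, by omega⟩
      have hx := congrFun (eq_of_linkOut_eq (h τ (by omega)) hτE) ⟨i, hi⟩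
      rw [diagCode_x hF, diagCode_x hF] at hx
      have hdi : (τ : ℤ) - (i : ℕ) = d := by omega
      simpa only [hdi] using hx
    · have hik : i < k := by omega
      have hz := fun s'' : ℕ → Fin k → F => eval_diagPoly hF s'' d ⟨i, hik⟩
      simp only [diagMessage, if_neg h0] at hz
      rw [hz, hz]
  rw [← diagMessage_sub_self s t j, ← diagMessage_sub_self s' t j, ← eval_diagPoly hF,
    ← eval_diagPoly hF, ← hd, hP]

end DiagonalCode

/-- A code achieves a delay spectrum as soon as the link outputs received by the deadline of a
symbol determine that symbol. -/
lemma SLCode.achieves_of_determined {F : Type} [Nonempty F] {n k : ℕ} (c : SLCode F n k) (N : ℕ)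
    (T : Fin k → ℕ)
    (h : ∀ (s s' : ℕ → Fin k → F) (E E' : Finset ℕ), E.card = N → E'.card = N →
      ∀ (t : ℕ) (j : Fin k), (∀ τ ≤ t + T j, linkOut E (c.x s) τ = linkOut E' (c.x s') τ) →
        s t j = s' t j) :
    c.Achieves N T := by
  classical
  refine ⟨fun t j y => Classical.epsilon fun a => ∃ (s : ℕ → Fin k → F) (E : Finset ℕ),
    E.card = N ∧ (fun t' : Fin (t + T j + 1) => linkOut E (c.x s) t') = y ∧ s t j = a,
    fun s E hE t j => ?_⟩
  obtain ⟨s', E', hE', hy, ha⟩ := Classical.epsilon_spec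
    (p := fun a => ∃ (s' : ℕ → Fin k → F) (E' : Finset ℕ), E'.card = N ∧
      (fun t' : Fin (t + T j + 1) => linkOut E' (c.x s') t') =
        (fun t' : Fin (t + T j + 1) => linkOut E (c.x s) t') ∧ s' t j = a)
    ⟨s t j, s, E, hE, rfl, rfl⟩
  refine ha.symm.trans (h s' s E' E hE' hE t j fun τ hτ => ?_)
  exact congrFun hy ⟨τ, by omega⟩

/-- For all integers `N ≥ 1` and `k ≥ 1` there is a finite field `F`
over which there is a systematic `(N + k; k)` point-to-point single-link code achieving
the delay spectrum `(N, N+1, …, N+k−1)` under `N` erasures, ordered so that the `j`-th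
symbol has delay `N + (k − 1 − j)` (zero-based indexing of `j`). -/
theorem stmt3 (N k : ℕ) (hN : 1 ≤ N) (hk : 1 ≤ k) :
    ∃ (F : Type) (_ : Field F) (_ : Fintype F) (c : SLCode F (N + k) k),
      c.Systematic (by omega) ∧
      c.Achieves N (fun j => N + (k - 1 - (j : ℕ))) := by
  obtain ⟨p, hp, hprime⟩ := Nat.exists_infinite_primes (N + k)
  have : Fact p.Prime := ⟨hprime⟩
  have hF : Set.InjOn (Nat.cast : ℕ → ZMod p) (Set.Iio (N + k)) :=
    (CharP.natCast_injOn_Iio (ZMod p) p).mono (Set.Iio_subset_Iio hp)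
  exact ⟨ZMod p, inferInstance, inferInstance, diagCode (ZMod p) N k,
    diagCode_systematic hF _, SLCode.achieves_of_determined _ _ _
      fun s s' E E' hE _ t j h => diagCode_recover hF hE.le h⟩
end

section
/- Let n > k ≥ 1, N ≥ 1 and T₁ ≥ N be integers. If a systematic (n; k) point-to-point single-link code achieves, under N erasures, a delay spectrum whose equally-delayed grouping has the consecutive delays T^(g) = (T₁, T₁−1, …, N+1, N) with counts k^(g)[1], …, k^(g)[ℓg], where ℓg = T₁ + 1 − N, then k^(g)[1] ≥ n − (T₁/N)·(n−k) and k^(g)[ℓg] ≤ (n−k)/N, as inequalities of rational numbers. -/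
open scoped BigOperators

namespace SLCode

variable {F : Type} {n k : ℕ}

/-- Encoders are causal. -/
theorem x_congr (c : SLCode F n k) {s s' : ℕ → Fin k → F} {t : ℕ}
    (h : ∀ u ≤ t, s u = s' u) : c.x s t = c.x s' t :=
  congrArg (c.enc t) (funext fun u => h u (Nat.lt_succ_iff.mp u.2))

/-- Two source sequences with the same link outputs up to time `t + T j` agree in the
symbol `j` at time `t`. -/
theorem Achieves.symbol_eq {c : SLCode F n k} {N : ℕ} {T : Fin k → ℕ} (hach : c.Achieves N T)
    {s s' : ℕ → Fin k → F} {E : Finset ℕ} (hE : E.card = N) {t : ℕ} {j : Fin k}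
    (h : ∀ u ≤ t + T j, u ∉ E → c.x s u = c.x s' u) : s t j = s' t j := by
  obtain ⟨dec, hdec⟩ := hach
  rw [← hdec s E hE t j, ← hdec s' E hE t j]
  congr 1
  funext u
  unfold linkOut
  split_ifs with hu
  · rfl
  · exact congrArg some (h u (Nat.lt_succ_iff.mp u.2) hu)

/-- Consider sources whose symbols of delay at least `W` vanish in the first `N` slots. These
are determined in the first `W` slots by the packets sent at the times `N, …, W - 1`. -/
theorem eq_of_packets_eq {c : SLCode F n k} {N W : ℕ} {T : Fin k → ℕ} {hkn : k ≤ n}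
    (hsys : c.Systematic hkn) (hach : c.Achieves N T) (hW : N ≤ W) {s s' : ℕ → Fin k → F}
    (hlong : ∀ u < N, ∀ j, W ≤ T j → s u j = s' u j)
    (hpackets : ∀ u, N ≤ u → u < W → c.x s u = c.x s' u) :
    ∀ u < W, s u = s' u := by
  intro u
  induction u using Nat.strong_induction_on with
  | _ u ih =>
    intro hu
    funext j
    rcases le_or_gt N u with hNu | huN
    · rw [← hsys s u j, ← hsys s' u j, hpackets u hNu hu]
    · rcases le_or_gt W (T j) with hj | hj
      · exact hlong u huN j hj
      · refine hach.symbol_eq (E := Finset.Ico u N ∪ Finset.Ico W (W + u)) ?_ ?_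
        · rw [Finset.card_union_of_disjoint, Nat.card_Ico, Nat.card_Ico]
          · omega
          · rw [Finset.disjoint_left]
            intro v hv
            simp only [Finset.mem_Ico] at hv ⊢
            omega
        · intro v hv hvE
          simp only [Finset.mem_union, Finset.mem_Ico] at hvE
          rcases lt_or_ge v u with hvu | hvu
          · exact c.x_congr fun w hw => ih w (by omega) (by omega)
          · exact hpackets v (by omega) (by omega)

/-- The rate bound for the symbols of delay less than `W`: the `W - N` packets of a window
that survive a burst of `N` erasures carry all of its short-delay symbols. -/
theorem card_delay_lt_mul_le [Fintype F] [Nontrivial F] {c : SLCode F n k} {N W : ℕ}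
    {T : Fin k → ℕ} {hkn : k ≤ n} (hsys : c.Systematic hkn) (hach : c.Achieves N T)
    (hW : N ≤ W) :
    N * (Finset.univ.filter fun i => T i < W).card + (W - N) * k ≤ (W - N) * n := by
  classical
  obtain ⟨z⟩ : Nonempty F := inferInstance
  let src (p : (Fin N × {i // T i < W} → F) × (Fin (W - N) × Fin k → F)) (u : ℕ)
      (j : Fin k) : F :=
    if hu : u < N then if hj : T j < W then p.1 (⟨u, hu⟩, ⟨j, hj⟩) else z
    else if hu : u - N < W - N then p.2 (⟨u - N, hu⟩, j) else z
  let packets (p : (Fin N × {i // T i < W} → F) × (Fin (W - N) × Fin k → F)) :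
      Fin (W - N) × Fin n → F := fun q => c.x (src p) (N + q.1) q.2
  have hinj : Function.Injective packets := by
    intro p p' hp
    have hsrc : ∀ u < W, src p u = src p' u := by
      refine eq_of_packets_eq hsys hach hW ?_ ?_
      · intro u hu j hj
        simp [src, hu, hj.not_gt]
      · intro u hNu hu
        funext i
        simpa [packets, Nat.add_sub_cancel' hNu] using
          congrFun hp (⟨u - N, by omega⟩, i)
    refine Prod.ext (funext ?_) (funext ?_)
    · rintro ⟨u, j⟩
      simpa [src, j.2] using congrFun (hsrc u (by omega)) j
    · rintro ⟨u, j⟩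
      simpa [src] using congrFun (hsrc (N + u) (by omega)) j
  have hcard := Fintype.card_le_of_injective packets hinj
  simp only [Fintype.card_prod, Fintype.card_fun, Fintype.card_fin, Fintype.card_subtype,
    ← pow_add] at hcard
  exact (Nat.pow_le_pow_iff_right Fintype.one_lt_card).mp hcard

end SLCode

/-- Let `n > k ≥ 1`, `N ≥ 1` and `T₁ ≥ N`.  If a systematic `(n; k)`
point-to-point single-link code achieves, under `N` erasures, a delay spectrum whose
equally-delayed grouping has the consecutive delays `(T₁, T₁−1, …, N+1, N)` (so the
`j`-th group, zero-based, has delay `T₁ − j` and there are `ℓg = T₁ + 1 − N` groups)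
with counts `kg`, then `kg 0 ≥ n − (T₁/N)·(n−k)` and `kg (ℓg−1) ≤ (n−k)/N`,
as inequalities of rational numbers. -/
theorem stmt6 (F : Type) [Field F] [Fintype F] (n k N T₁ : ℕ)
    (hk : 1 ≤ k) (hnk : k < n) (hN : 1 ≤ N) (hT₁ : N ≤ T₁)
    (T : Fin k → ℕ) (kg : Fin (T₁ + 1 - N) → ℕ)
    (hcount : ∀ j : Fin (T₁ + 1 - N),
      kg j = (Finset.univ.filter (fun i => T i = T₁ - (j : ℕ))).card)
    (hcover : ∀ i : Fin k, ∃ j : Fin (T₁ + 1 - N), T i = T₁ - (j : ℕ))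
    (c : SLCode F n k) (hsys : c.Systematic (le_of_lt hnk)) (hach : c.Achieves N T) :
    (n : ℚ) - ((T₁ : ℚ) / N) * ((n : ℚ) - k) ≤ (kg ⟨0, by omega⟩ : ℚ) ∧
      (kg ⟨T₁ - N, by omega⟩ : ℚ) ≤ ((n : ℚ) - k) / N := by
  have hN' : (0 : ℚ) < N := by exact_mod_cast hN
  constructor
  · have h := SLCode.card_delay_lt_mul_le hsys hach hT₁
    have hsplit := Finset.card_filter_add_card_filter_not (s := Finset.univ)
      (fun i : Fin k => T i < T₁)
    have hlong : (Finset.univ.filter fun i => ¬ T i < T₁).card = kg ⟨0, by omega⟩ := by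
      rw [hcount]
      congr 1
      ext i
      obtain ⟨j, hj⟩ := hcover i
      simp only [Finset.mem_filter, Finset.mem_univ, true_and]
      omega
    rw [hlong, Finset.card_univ, Fintype.card_fin] at hsplit
    zify [hT₁] at h
    have hq : (N : ℚ) * (Finset.univ.filter fun i => T i < T₁).card + (T₁ - N) * k
        ≤ (T₁ - N) * n := by exact_mod_cast h
    have hsplit' : ((Finset.univ.filter fun i => T i < T₁).card : ℚ) + kg ⟨0, by omega⟩ = k := by
      exact_mod_cast hsplit
    rw [sub_le_iff_le_add, div_mul_eq_mul_div, ← sub_le_iff_le_add', le_div_iff₀ hN']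
    rw [← eq_sub_iff_add_eq] at hsplit'
    rw [hsplit'] at hq
    linarith
  · have h := SLCode.card_delay_lt_mul_le hsys hach (Nat.le_succ N)
    have hshort : (Finset.univ.filter fun i => T i < N.succ).card = kg ⟨T₁ - N, by omega⟩ := by
      rw [hcount]
      congr 1
      ext i
      obtain ⟨j, hj⟩ := hcover i
      simp only [Finset.mem_filter, Finset.mem_univ, true_and]
      omega
    rw [hshort, Nat.succ_eq_add_one, Nat.add_sub_cancel_left, one_mul, one_mul] at h
    rw [le_div_iff₀ hN', le_sub_iff_add_le, mul_comm]
    exact_mod_cast h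
end

section
/- Let n > k ≥ 1 and N ≥ 1 be integers such that (n−k)/N is an integer, and let T₁ ≥ N be an integer with N·n/(n−k) − 1 ≤ T₁ ≤ N·n/(n−k), so that k^(g)[1] := n − (T₁/N)·(n−k) satisfies 0 ≤ k^(g)[1] ≤ (n−k)/N. Then there exists a finite field 𝔽 (any sufficiently large finite field suffices) over which there is an (n; k) point-to-point single-link code that, under N erasures, recovers from each source packet exactly k^(g)[1] symbols with delay T₁ and exactly (n−k)/N symbols with each delay in {N, N+1, …, T₁−1}. -/
open scoped BigOperators

namespace SLCode

section Causal

variable {F : Type} {n k : ℕ}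

/-- The code whose packets are given by a causal map `X` on infinite source sequences. -/
def ofCausal [Zero F] (X : (ℕ → Fin k → F) → ℕ → Fin n → F) : SLCode F n k where
  enc t s := X (fun u => if h : u < t + 1 then s ⟨u, h⟩ else 0) t

theorem ofCausal_x [Zero F] {X : (ℕ → Fin k → F) → ℕ → Fin n → F}
    (hX : ∀ s s' t, (∀ u ≤ t, s u = s' u) → X s t = X s' t) (s : ℕ → Fin k → F) (t : ℕ) :
    (ofCausal X).x s t = X s t := by
  refine hX _ _ _ fun u hu => ?_
  simp [Nat.lt_succ_of_le hu]

/-- A delay spectrum is achieved as soon as each source symbol is determined by the packets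
that arrive before its deadline. -/
theorem achieves_of_determined_s9 [Zero F] {c : SLCode F n k} {N : ℕ} {T : Fin k → ℕ}
    (h : ∀ (s s' : ℕ → Fin k → F) (E : Finset ℕ), E.card = N → ∀ (t : ℕ) (j : Fin k),
      (∀ u ≤ t + T j, u ∉ E → c.x s u = c.x s' u) → s t j = s' t j) :
    c.Achieves N T := by
  classical
  refine ⟨fun t j y => if hy : ∃ s : ℕ → Fin k → F, ∃ E : Finset ℕ, E.card = N ∧
      (fun t' : Fin (t + T j + 1) => linkOut E (fun u => c.x s u) t') = y
      then hy.choose t j else 0, fun s E hE t j => ?_⟩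
  have hy : ∃ s' : ℕ → Fin k → F, ∃ E' : Finset ℕ, E'.card = N ∧
      (fun t' : Fin (t + T j + 1) => linkOut E' (fun u => c.x s' u) t') =
        fun t' : Fin (t + T j + 1) => linkOut E (fun u => c.x s u) t' := ⟨s, E, hE, rfl⟩
  simp only [dif_pos hy]
  obtain ⟨E', -, heq⟩ := hy.choose_spec
  refine h _ _ E hE t j fun u hu huE => ?_
  have hu' := congrFun heq ⟨u, Nat.lt_succ_of_le hu⟩
  simp only [linkOut, if_neg huE] at hu'
  split_ifs at hu' with huE'
  exact Option.some.inj hu'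

end Causal

section Diagonal

variable {F : Type} [Field F] {n k : ℕ}

/-- The data symbol in position `q` (counted backwards from the last one) of the diagonal
codeword of layer `l` that ends at time `e`; it is zero outside the range of the source. -/
def diagData (m N : ℕ) (s : ℕ → Fin k → F) (l e q : ℕ) : F :=
  if h : q ≤ e ∧ l + m * q - m * N < k then s (e - q) ⟨l + m * q - m * N, h.2⟩ else 0

/-- The Reed–Solomon polynomial of the diagonal codeword of layer `l` that ends at time `e`. -/
noncomputable def diagPoly (n m N : ℕ) (s : ℕ → Fin k → F) (l e : ℕ) : Polynomial F :=
  Lagrange.interpolate (Finset.Ico N n) (fun q : ℕ => (q : F)) (diagData m N s l e)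

/-- The packets of `m` diagonally interleaved systematic Reed–Solomon codes:
coordinate `j` carries position `j / m` of a codeword of layer `j % m`. -/
noncomputable def diagPacket (m N : ℕ) (s : ℕ → Fin k → F) (t : ℕ) (j : Fin n) : F :=
  (diagPoly n m N s (j % m) (t + j / m)).eval ((j / m : ℕ) : F)

variable {m N : ℕ}

theorem eval_diagPoly (hF : Set.InjOn (fun q : ℕ => (q : F)) (Set.Iio n))
    (s : ℕ → Fin k → F) (l e : ℕ) {q : ℕ} (hNq : N ≤ q) (hqn : q < n) :
    (diagPoly n m N s l e).eval (q : F) = diagData m N s l e q :=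
  Lagrange.eval_interpolate_at_node (v := fun q : ℕ => (q : F)) _
    (hF.mono fun a ha => by simp at ha; exact ha.2) (Finset.mem_Ico.2 ⟨hNq, hqn⟩)

theorem degree_diagPoly_lt (hF : Set.InjOn (fun q : ℕ => (q : F)) (Set.Iio n))
    (s : ℕ → Fin k → F) (l e : ℕ) :
    (diagPoly n m N s l e).degree < (n - N : ℕ) := by
  simpa [diagPoly] using Lagrange.degree_interpolate_lt (s := Finset.Ico N n)
    (v := fun q : ℕ => (q : F)) (diagData m N s l e)
    (hF.mono fun a ha => by simp at ha; exact ha.2)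

theorem diagPacket_causal (hF : Set.InjOn (fun q : ℕ => (q : F)) (Set.Iio n))
    (s s' : ℕ → Fin k → F) (t : ℕ) (h : ∀ u ≤ t, s u = s' u) :
    diagPacket (n := n) m N s t = diagPacket m N s' t := by
  funext j
  have hj : (j : ℕ) / m < n := (Nat.div_le_self _ _).trans_lt j.2
  unfold diagPacket
  rcases le_or_gt N (j / m) with hN | hN
  · rw [eval_diagPoly hF _ _ _ hN hj, eval_diagPoly hF _ _ _ hN hj]
    simp [diagData, h t le_rfl]
  · unfold diagPoly
    simp only [Lagrange.interpolate_apply]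
    congr 1
    refine Finset.sum_congr rfl fun q hq => ?_
    have hq' := (Finset.mem_Ico.1 hq).1
    unfold diagData
    rw [h _ (by omega)]

/-- A diagonal codeword is determined by the packets received up to its last symbol. -/
theorem diagPoly_eq_of_received (hF : Set.InjOn (fun q : ℕ => (q : F)) (Set.Iio n))
    (hn : n = k + m * N) {s s' : ℕ → Fin k → F} {E : Finset ℕ} (hE : E.card = N)
    {l e : ℕ} (hl : l < m) (he : N ≤ e) (hlN : l + m * N < n)
    (h : ∀ u ≤ e, u ∉ E → diagPacket (n := n) m N s u = diagPacket m N s' u) :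
    diagPoly n m N s l e = diagPoly n m N s' l e := by
  classical
  set B := E.image fun u => e - u with hB
  have hBcard : B.card ≤ N := hE ▸ Finset.card_image_le
  have hdeg (r : ℕ → Fin k → F) :
      (diagPoly n m N r l e).degree < (Finset.range n \ B).card := by
    refine (degree_diagPoly_lt hF r l e).trans_le ?_
    have := Finset.le_card_sdiff B (Finset.range n)
    rw [Finset.card_range] at this
    exact_mod_cast (by omega : n - N ≤ _)
  refine Polynomial.eq_of_degrees_lt_of_eval_index_eq (v := fun q : ℕ => (q : F))
    (Finset.range n \ B) (hF.mono fun a ha => by simp at ha; exact ha.1) (hdeg s) (hdeg s') ?_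
  intro q hq
  obtain ⟨hqn, hqB⟩ := Finset.mem_sdiff.1 hq
  rw [Finset.mem_range] at hqn
  by_cases hr : q ≤ e ∧ l + m * q < n
  · have huE : e - q ∉ E := fun hu => hqB (Finset.mem_image.2 ⟨_, hu, by omega⟩)
    have := congrFun (h (e - q) (Nat.sub_le _ _) huE) ⟨l + m * q, hr.2⟩
    simpa [diagPacket, Nat.add_mul_div_left _ _ (Nat.zero_lt_of_lt hl), Nat.mod_eq_of_lt hl,
      Nat.div_eq_of_lt hl, Nat.sub_add_cancel hr.1] using this
  · have hNq : N ≤ q := by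
      by_contra! hlt
      have := Nat.mul_le_mul_left m hlt.le
      exact hr ⟨by omega, by omega⟩
    have hout : ¬ (q ≤ e ∧ l + m * q - m * N < k) := by
      have := Nat.mul_le_mul_left m hNq
      omega
    rw [eval_diagPoly hF _ _ _ hNq hqn, eval_diagPoly hF _ _ _ hNq hqn]
    simp [diagData, hout]

/-- The diagonally interleaved code recovers the source symbol `j` with delay `N + j / m`. -/
theorem achieves_diag (hF : Set.InjOn (fun q : ℕ => (q : F)) (Set.Iio n)) (hm : 0 < m)
    (hn : n = k + m * N) :
    (ofCausal (diagPacket (F := F) (n := n) (k := k) m N)).Achieves N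
      fun j => N + j / m := by
  refine achieves_of_determined_s9 fun s s' E hE t j h => ?_
  simp only [ofCausal_x (diagPacket_causal hF)] at h
  have hj := j.2
  have hdm := Nat.mod_add_div (j : ℕ) m
  have hml := Nat.mod_lt (j : ℕ) hm
  have hjm := Nat.div_le_self (j : ℕ) m
  have hNm := Nat.le_mul_of_pos_left N hm
  have hP := diagPoly_eq_of_received hF hn (s := s) (s' := s') hE (l := j % m)
    (e := t + (N + j / m)) hml
    ((Nat.le_add_right N _).trans (Nat.le_add_left _ t)) (by omega) h
  have hev (r : ℕ → Fin k → F) :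
      (diagPoly n m N r (j % m) (t + (N + j / m))).eval ((N + j / m : ℕ) : F) = r t j := by
    rw [eval_diagPoly hF _ _ _ (Nat.le_add_right N _) (by omega)]
    have hidx : (j : ℕ) % m + m * (N + j / m) - m * N = j := by
      rw [Nat.mul_add]; omega
    simp [diagData, hidx]
  rw [← hev s, hP, hev s']

end Diagonal

end SLCode

theorem card_filter_add_div_eq (k m N τ : ℕ) (hm : 0 < m) (hτ : N ≤ τ) :
    (Finset.univ.filter fun j : Fin k => N + (j : ℕ) / m = τ).card =
      min k (m * (τ - N) + m) - m * (τ - N) := by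
  rw [← Nat.card_Ico, ← Finset.card_map Fin.valEmbedding]
  congr 1
  ext a
  simp only [Finset.mem_map, Finset.mem_filter, Finset.mem_univ, true_and, Fin.valEmbedding_apply,
    Finset.mem_Ico, lt_min_iff]
  have key : N + a / m = τ ↔ m * (τ - N) ≤ a ∧ a < m * (τ - N) + m := by
    have h : N + a / m = τ ↔ a / m = τ - N := by omega
    rw [h, Nat.div_eq_iff hm, mul_comm]
    omega
  constructor
  · rintro ⟨j, hj, rfl⟩
    exact ⟨(key.1 hj).1, j.2, (key.1 hj).2⟩
  · rintro ⟨h₁, h₂, h₃⟩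
    exact ⟨⟨a, h₂⟩, key.2 ⟨h₁, h₃⟩, rfl⟩

/-- **Achievability.** Let `n > k ≥ 1` and `N ≥ 1` with `N ∣ (n − k)`, and
let `T₁ ≥ N` satisfy `N·n/(n−k) − 1 ≤ T₁ ≤ N·n/(n−k)` (as rationals), so that
`kg₁ := n − (T₁/N)·(n−k) = n − T₁·((n−k)/N)` satisfies `0 ≤ kg₁ ≤ (n−k)/N`.
Then over some (sufficiently large) finite field there is an `(n; k)` point-to-point
single-link code that, under `N` erasures, recovers from each source packet exactly
`kg₁` symbols with delay `T₁` and exactly `(n−k)/N` symbols with each delay in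
`{N, N+1, …, T₁−1}` (i.e. its delay spectrum has exactly these numbers of entries
equal to these delays). -/
theorem stmt9 (n k N T₁ : ℕ) (hk : 1 ≤ k) (hnk : k < n) (hN : 1 ≤ N)
    (hdvd : N ∣ (n - k)) (hT₁ : N ≤ T₁)
    (hlb : (N : ℚ) * n / ((n : ℚ) - k) - 1 ≤ (T₁ : ℚ))
    (hub : (T₁ : ℚ) ≤ (N : ℚ) * n / ((n : ℚ) - k)) :
    ∃ (F : Type) (_ : Field F) (_ : Fintype F) (c : SLCode F n k) (T : Fin k → ℕ),
      c.Achieves N T ∧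
      (Finset.univ.filter (fun j => T j = T₁)).card = n - T₁ * ((n - k) / N) ∧
      ∀ τ : ℕ, N ≤ τ → τ < T₁ →
        (Finset.univ.filter (fun j => T j = τ)).card = (n - k) / N := by
  obtain ⟨m, hm⟩ := hdvd
  have hm0 : 0 < m := Nat.pos_of_ne_zero (by rintro rfl; omega)
  have hn : n = k + m * N := by rw [mul_comm]; omega
  have hdiv : (n - k) / N = m := by rw [hm, Nat.mul_div_cancel_left _ hN]
  have hmQ : (0 : ℚ) < m := by exact_mod_cast hm0
  have hNQ : (0 : ℚ) < N := by exact_mod_cast hN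
  have hfrac : (N : ℚ) * n / ((n : ℚ) - k) = n / m := by
    have : (n : ℚ) - k = m * N := by rw [hn]; push_cast; ring
    rw [this]
    field_simp
  rw [hfrac] at hlb hub
  have hle : m * T₁ ≤ n := by
    rw [le_div_iff₀ hmQ, mul_comm] at hub
    exact_mod_cast hub
  have hge : n ≤ m * T₁ + m := by
    rw [sub_le_iff_le_add, div_le_iff₀ hmQ, add_mul, one_mul, mul_comm] at hlb
    exact_mod_cast hlb
  obtain ⟨p, hpn, hp⟩ := Nat.exists_infinite_primes n
  have := Fact.mk hp
  have hF : Set.InjOn (fun q : ℕ => (q : ZMod p)) (Set.Iio n) := fun a ha b hb hab =>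
    Nat.ModEq.eq_of_lt_of_lt ((ZMod.natCast_eq_natCast_iff _ _ _).1 hab)
      (lt_of_lt_of_le ha hpn) (lt_of_lt_of_le hb hpn)
  refine ⟨ZMod p, inferInstance, inferInstance, _, _,
    SLCode.achieves_diag (N := N) hF hm0 hn, ?_, fun τ hτ hτ' => ?_⟩
  · rw [hdiv, card_filter_add_div_eq k m N T₁ hm0 hT₁, Nat.mul_sub, mul_comm T₁]
    have := Nat.mul_le_mul_left m hT₁
    omega
  · rw [hdiv, card_filter_add_div_eq k m N τ hm0 hτ, Nat.mul_sub]
    have := Nat.mul_le_mul_left m hτ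
    have : m * τ + m ≤ m * T₁ := Nat.mul_le_mul_left m hτ'
    omega
end

section
/- Let L₁, L₂ ≥ 1 be integers, T a real number, and N^(1) : {1,…,L₁} → ℝ, N^(2) : {1,…,L₂} → ℝ functions with T + 1 − N^(1)_i > 0 for all i and T + 1 − N^(2)_j > 0 for all j. Let N̄^(1) = (1/L₁)·Σ_{i=1}^{L₁} N^(1)_i and N̄^(2) = (1/L₂)·Σ_{j=1}^{L₂} N^(2)_j. Then (Σ_{i=1}^{L₁} Σ_{j=1}^{L₂} max(T + 1 − N^(1)_i − N^(2)_j, 0)) / max(Σ_{j=1}^{L₂} (T + 1 − N^(2)_j), Σ_{i=1}^{L₁} (T + 1 − N^(1)_i)) ≥ (T + 1 − N̄^(2) − N̄^(1)) / max((T − N̄^(2) + 1)/L₁, (T − N̄^(1) + 1)/L₂). -/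
open scoped BigOperators

/-- **closed-form lower bound on the rate of concatenated symbol-wise
decode-and-forward.** For real `T` and erasure numbers `N1, N2` with
`T + 1 − N1 i > 0` and `T + 1 − N2 j > 0` for all links, the achieved rate
`(Σ_{i,j} (T + 1 − N1 i − N2 j)^+) / max(Σ_j (T + 1 − N2 j), Σ_i (T + 1 − N1 i))`
is at least
`(T + 1 − N̄2 − N̄1) / max((T − N̄2 + 1)/L1, (T − N̄1 + 1)/L2)`, where `N̄1, N̄2` are
the average erasure numbers on the two hops. -/
theorem stmt12 (L1 L2 : ℕ) (hL1 : 1 ≤ L1) (hL2 : 1 ≤ L2) (T : ℝ)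
    (N1 : Fin L1 → ℝ) (N2 : Fin L2 → ℝ)
    (h1 : ∀ i, 0 < T + 1 - N1 i) (h2 : ∀ j, 0 < T + 1 - N2 j) :
    (T + 1 - (∑ j, N2 j) / L2 - (∑ i, N1 i) / L1) /
        max ((T - (∑ j, N2 j) / L2 + 1) / L1) ((T - (∑ i, N1 i) / L1 + 1) / L2) ≤
      (∑ i, ∑ j, max (T + 1 - N1 i - N2 j) 0) /
        max (∑ j, (T + 1 - N2 j)) (∑ i, (T + 1 - N1 i)) := by
  have hp1 : (0 : ℝ) < L1 := by exact_mod_cast hL1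
  have hp2 : (0 : ℝ) < L2 := by exact_mod_cast hL2
  have : Nonempty (Fin L1) := ⟨⟨0, hL1⟩⟩
  have hpos : 0 < max (∑ j, (T + 1 - N2 j)) (∑ i, (T + 1 - N1 i)) :=
    lt_max_of_lt_right (Finset.sum_pos (fun i _ => h1 i) Finset.univ_nonempty)
  have hden : max (∑ j, (T + 1 - N2 j)) (∑ i, (T + 1 - N1 i)) =
      (L1 * L2 : ℝ) *
        max ((T - (∑ j, N2 j) / L2 + 1) / L1) ((T - (∑ i, N1 i) / L1 + 1) / L2) := by
    rw [mul_max_of_nonneg _ _ (by positivity)]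
    congr 1
    · simp only [Finset.sum_sub_distrib, Finset.sum_const, Finset.card_univ, Fintype.card_fin,
        nsmul_eq_mul]
      field_simp
      ring
    · simp only [Finset.sum_sub_distrib, Finset.sum_const, Finset.card_univ, Fintype.card_fin,
        nsmul_eq_mul]
      field_simp
      ring
  have hnum : (L1 * L2 : ℝ) * (T + 1 - (∑ j, N2 j) / L2 - (∑ i, N1 i) / L1) ≤
      ∑ i, ∑ j, max (T + 1 - N1 i - N2 j) 0 := by
    calc (L1 * L2 : ℝ) * (T + 1 - (∑ j, N2 j) / L2 - (∑ i, N1 i) / L1)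
        = ∑ i, ∑ j, (T + 1 - N1 i - N2 j) := by
          simp only [Finset.sum_sub_distrib, Finset.sum_const, Finset.card_univ,
            Fintype.card_fin, nsmul_eq_mul, ← Finset.mul_sum]
          field_simp
          ring
      _ ≤ _ := Finset.sum_le_sum fun i _ => Finset.sum_le_sum fun j _ => le_max_left _ _
  rw [← mul_div_mul_left _ _ (mul_pos hp1 hp2).ne', ← hden]
  exact div_le_div_of_nonneg_right hnum hpos.le
end

section
/- Let L₁, L₂ ≥ 1 be integers, T a real number, and N^(1) : {1,…,L₁} → ℝ, N^(2) : {1,…,L₂} → ℝ functions with N^(1)_i > 0 for all i and N^(2)_j > 0 for all j. Let N̄^(1), N̄^(2) denote the averages, m₁ = min_i N^(1)_i, m₂ = min_j N^(2)_j, and assume T + 1 > N̄^(1) + N̄^(2). Assume further that the first hop is the bottleneck in both expressions, i.e., (T + 1 − N̄^(2))/L₁ ≥ (T + 1 − N̄^(1))/L₂ and L₁·(T + 1 − m₂ − N̄^(1))/(T + 1 − m₂) ≤ L₂·(T + 1 − m₁ − N̄^(2))/(T + 1 − m₁). Then (T + 1 − N̄^(2) − N̄^(1)) / max((T + 1 −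 N̄^(2))/L₁, (T + 1 − N̄^(1))/L₂) = min(L₁·(T + 1 − m₂ − N̄^(1))/(T + 1 − m₂), L₂·(T + 1 − m₁ − N̄^(2))/(T + 1 − m₁)) if and only if N^(2)_j = m₂ for all j ∈ {1,…,L₂}. -/
open scoped BigOperators

/-- The average of a finite nonempty family bounded below by `m` is at least `m`. -/
theorem le_average_of_forall_le {n : ℕ} (hn : 1 ≤ n) {f : Fin n → ℝ} {m : ℝ}
    (h : ∀ i, m ≤ f i) : m ≤ (∑ i, f i) / n := by
  have hn' : (0 : ℝ) < n := by exact_mod_cast hn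
  rw [le_div_iff₀ hn', mul_comm]
  simpa using Finset.sum_le_sum (fun i (_ : i ∈ Finset.univ) => h i)

/-- The average of a finite nonempty family bounded below by `m` equals `m` iff the family
is constantly `m`. -/
theorem average_eq_iff_of_forall_le {n : ℕ} (hn : 1 ≤ n) {f : Fin n → ℝ} {m : ℝ}
    (h : ∀ i, m ≤ f i) : (∑ i, f i) / n = m ↔ ∀ i, f i = m := by
  have hn' : (0 : ℝ) < n := by exact_mod_cast hn
  have key := Finset.sum_eq_sum_iff_of_le (fun i (_ : i ∈ Finset.univ) => h i)
  simp only [Finset.sum_const, Finset.card_univ, Fintype.card_fin, nsmul_eq_mul,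
    Finset.mem_univ, true_imp_iff] at key
  rw [div_eq_iff hn'.ne', mul_comm, eq_comm, key]
  exact forall_congr' fun _ => eq_comm

/-- **Proposition 2.** With `N̄1, N̄2` the average and `m1, m2` the minimum
numbers of erasures on the two hops, `T + 1 > N̄1 + N̄2`, and the first hop being the
bottleneck in both the scheme's rate and the upper bound, the rate of the concatenated
symbol-wise decode-and-forward scheme equals the information-theoretic upper bound
iff the maximal numbers of erasures on all links of the second hop are equal. -/
theorem stmt13 (L1 L2 : ℕ) (hL1 : 1 ≤ L1) (hL2 : 1 ≤ L2) (T : ℝ)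
    (N1 : Fin L1 → ℝ) (N2 : Fin L2 → ℝ)
    (hN1 : ∀ i, 0 < N1 i) (hN2 : ∀ j, 0 < N2 j)
    (Nbar1 Nbar2 m1 m2 : ℝ)
    (hNbar1 : Nbar1 = (∑ i, N1 i) / L1) (hNbar2 : Nbar2 = (∑ j, N2 j) / L2)
    (hm1 : m1 = Finset.univ.inf' ⟨⟨0, hL1⟩, Finset.mem_univ _⟩ N1)
    (hm2 : m2 = Finset.univ.inf' ⟨⟨0, hL2⟩, Finset.mem_univ _⟩ N2)
    (hT : Nbar1 + Nbar2 < T + 1)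
    (hbn1 : (T + 1 - Nbar1) / L2 ≤ (T + 1 - Nbar2) / L1)
    (hbn2 : L1 * (T + 1 - m2 - Nbar1) / (T + 1 - m2) ≤
      L2 * (T + 1 - m1 - Nbar2) / (T + 1 - m1)) :
    (T + 1 - Nbar2 - Nbar1) / max ((T + 1 - Nbar2) / L1) ((T + 1 - Nbar1) / L2) =
        min (L1 * (T + 1 - m2 - Nbar1) / (T + 1 - m2))
          (L2 * (T + 1 - m1 - Nbar2) / (T + 1 - m1)) ↔
      ∀ j : Fin L2, N2 j = m2 := by
  have hL1' : (0 : ℝ) < L1 := by exact_mod_cast hL1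
  have hle : ∀ j, m2 ≤ N2 j := fun j => hm2 ▸ Finset.inf'_le _ (Finset.mem_univ j)
  have hm2le : m2 ≤ Nbar2 := hNbar2 ▸ le_average_of_forall_le hL2 hle
  have hpos1 : 0 < Nbar1 := by
    rw [hNbar1]
    exact div_pos (Finset.sum_pos (fun i _ => hN1 i) ⟨⟨0, hL1⟩, Finset.mem_univ _⟩) hL1'
  have hA : 0 < T + 1 - Nbar2 := by linarith
  have hB : 0 < T + 1 - m2 := by linarith
  rw [max_eq_left hbn1, min_eq_left hbn2, ← average_eq_iff_of_forall_le hL2 hle, ← hNbar2,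
    div_div_eq_mul_div, div_eq_div_iff hA.ne' hB.ne']
  constructor
  · intro h
    have h0 : (L1 * Nbar1) * (Nbar2 - m2) = 0 := by linear_combination -h
    rcases mul_eq_zero.mp h0 with h1 | h1
    · exact absurd h1 (by positivity)
    · linarith
  · rintro rfl
    ring
end

section
/- Suppose there exists an (n^(1)_1,…,n^(1)_{L₁}; k) point-to-point L₁-links code achieving delay spectrum T^(1) under (N^(1)_1,…,N^(1)_{L₁}) erasures, an (n^(2)_1,…,n^(2)_{L₂}; k) point-to-point L₂-links code achieving delay spectrum T^(2) under (N^(2)_1,…,N^(2)_{L₂}) erasures, and a permutation π of {1,…,k} such that T^(1)[j] + T^(2)[π(j)] ≤ T for every j ∈ {1,…,k}. Then there exists an (n^(1), n^(2), k, T) streaming code for the three-node relay network that is (N^(1), N^(2))-achievable: for every source sequence and every admissible choice of erasure sequences, the destination's estimate at time t + T satisfies ŝ_t = s_t for all t. -/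
open scoped BigOperators

/-- Source packet re-encoded by the relay at time `u`: its symbol `π j` is the estimate of
symbol `j` of the packet sent `T1 j` time slots earlier, or `0` if there is no such packet. -/
def relayPacket {F Y : Type*} [Zero F] {k : ℕ} {T1 : Fin k → ℕ} (π : Equiv.Perm (Fin k))
    (dec : (t : ℕ) → (j : Fin k) → (Fin (t + T1 j + 1) → Y) → F)
    (y : ℕ → Y) (u : ℕ) (j : Fin k) : F :=
  if T1 (π.symm j) ≤ u then dec (u - T1 (π.symm j)) (π.symm j) (fun t' => y t') else 0

theorem relayPacket_congr {F Y : Type*} [Zero F] {k : ℕ} {T1 : Fin k → ℕ}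
    (π : Equiv.Perm (Fin k)) (dec : (t : ℕ) → (j : Fin k) → (Fin (t + T1 j + 1) → Y) → F)
    {y y' : ℕ → Y} {u : ℕ} (h : ∀ m ≤ u, y m = y' m) :
    relayPacket π dec y u = relayPacket π dec y' u := by
  funext j
  unfold relayPacket
  split_ifs with hu
  · congr 1
    funext t'
    exact h t' (by omega)
  · rfl

/-- If there is an `(n1; k)` point-to-point `L1`-links code achieving
delay spectrum `T1` under `N1` erasures, an `(n2; k)` point-to-point `L2`-links code
achieving delay spectrum `T2` under `N2` erasures, and a permutation `π` of the symbols
with `T1 j + T2 (π j) ≤ T` for every `j`, then there is an `(n1, n2, k, T)` streaming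
code for the three-node relay network that is `(N1, N2)`-achievable: for every source
sequence and every admissible choice of erasure sequences, the destination's estimate
at time `t + T` equals `s t` for all `t`. -/
theorem stmt14 (F : Type) [Field F] [Fintype F] (L1 L2 k : ℕ)
    (n1 N1 : Fin L1 → ℕ) (n2 N2 : Fin L2 → ℕ) (T1 T2 : Fin k → ℕ) (T : ℕ)
    (h1 : ∃ c : PtPCode F L1 k n1, c.Achieves N1 T1)
    (h2 : ∃ c : PtPCode F L2 k n2, c.Achieves N2 T2)
    (π : Equiv.Perm (Fin k)) (hT : ∀ j : Fin k, T1 j + T2 (π j) ≤ T) :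
    ∃ c : RelayCode F L1 L2 k n1 n2, c.Achievable N1 N2 T := by
  obtain ⟨c1, dec1, hdec1⟩ := h1
  obtain ⟨c2, dec2, hdec2⟩ := h2
  refine ⟨⟨c1.enc, fun t i y => c2.enc t i fun u =>
      relayPacket π dec1 (fun m l => if h : m < t + 1 then y ⟨m, h⟩ l else none) u⟩,
    fun t y j => dec2 (t + T1 j) (π j) fun t' => y ⟨t', by have := hT j; omega⟩, ?_⟩
  intro s E1 E2 hE1 hE2 t
  funext j
  set s' := relayPacket π dec1 fun m l => linkOut (E1 l) (fun v => c1.x s v l) m with hs'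
  have hx2 : ∀ t i, RelayCode.x2 ⟨c1.enc, fun t i y => c2.enc t i fun u =>
      relayPacket π dec1 (fun m l => if h : m < t + 1 then y ⟨m, h⟩ l else none) u⟩
      s E1 t i = c2.x s' t i := by
    intro t i
    refine congrArg (c2.enc t i) (funext fun u => relayPacket_congr π dec1 fun m hm => ?_)
    funext l
    exact dif_pos (by omega)
  simp only [hx2]
  rw [hdec2 s' E2 hE2, hs', relayPacket, if_pos (by simp), hdec1 s E1 hE1]
  simp
end

section
/- Let L₁, L₂ ≥ 1, let T be a positive integer, and let N^(1) : {1,…,L₁} → ℤ₊ and N^(2) : {1,…,L₂} → ℤ₊ be positive integers with T + 1 > N^(1)_i for all i and T + 1 > N^(2)_j for all j. Then there exists a finite field 𝔽 (any sufficiently large finite field suffices) over which there is an (n^(1), n^(2), k, T) streaming code for the three-node relay network that is (N^(1), N^(2))-achievable with k = Σ_{i=1}^{L₁} Σ_{j=1}^{L₂} max(T + 1 − N^(1)_i − N^(2)_j, 0), n^(1)_i = Σ_{j=1}^{L₂} (T + 1 − N^(2)_j) for every first-hop link i, and n^(2)_j = Σ_{i=1}^{L₁} (T + 1 − N^(1)_i)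 for every second-hop link j; in particular its rate equals Σ_{i,j} (T + 1 − N^(1)_i − N^(2)_j)^+ / max(Σ_j (T + 1 − N^(2)_j), Σ_i (T + 1 − N^(1)_i)). -/
open scoped BigOperators

/-- Coordinate `p` of the systematic Reed–Solomon codeword with evaluation points `v`
and message symbols `f 0, …, f (k - 1)`. -/
noncomputable def rsCoord {F : Type} [Field F] (v : ℕ → F) (k : ℕ) (f : ℕ → F) (p : ℕ) : F :=
  (Lagrange.interpolate (Finset.range k) v f).eval (v p)

/-- Systematic Reed–Solomon codewords are causal: coordinate `p` only depends on the message
symbols with index at most `p`. -/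
lemma rsCoord_congr {F : Type} [Field F] {v : ℕ → F} {k p : ℕ} {f g : ℕ → F}
    (hv : Set.InjOn v (Finset.range k)) (h : ∀ l < k, l ≤ p → f l = g l) :
    rsCoord v k f p = rsCoord v k g p := by
  unfold rsCoord
  rcases lt_or_ge p k with hp | hp
  · rw [Lagrange.eval_interpolate_at_node f hv (Finset.mem_range.2 hp),
      Lagrange.eval_interpolate_at_node g hv (Finset.mem_range.2 hp), h p hp le_rfl]
  · rw [Lagrange.interpolate_eq_of_values_eq_on]
    intro l hl
    rw [Finset.mem_range] at hl
    exact h l hl (by omega)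

/-- A Reed–Solomon codeword of length `k + N` is determined by its coordinates outside any set
of `N` positions. -/
lemma eq_of_rsCoord_eq {F : Type} [Field F] {v : ℕ → F} {k N : ℕ} {f g : ℕ → F}
    (hv : Set.InjOn v (Finset.range (k + N))) {B : Finset ℕ} (hB : B.card ≤ N)
    (h : ∀ p < k + N, p ∉ B → rsCoord v k f p = rsCoord v k g p) :
    ∀ l < k, f l = g l := by
  have hvk : Set.InjOn v (Finset.range k) := hv.mono (by
    intro x hx
    simp only [Finset.coe_range, Set.mem_Iio] at hx ⊢
    omega)
  have hcard : k ≤ (Finset.range (k + N) \ B).card := by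
    have := Finset.le_card_sdiff B (Finset.range (k + N))
    rw [Finset.card_range] at this
    omega
  have hdeg (f : ℕ → F) : (Lagrange.interpolate (Finset.range k) v f).degree <
      (Finset.range (k + N) \ B).card := by
    refine (Lagrange.degree_interpolate_lt f hvk).trans_le ?_
    rw [Finset.card_range]
    exact_mod_cast hcard
  have heq := Polynomial.eq_of_degrees_lt_of_eval_index_eq (Finset.range (k + N) \ B)
    (hv.mono (by simp only [Finset.coe_sdiff]; exact Set.sdiff_subset)) (hdeg f) (hdeg g) (by
      intro p hp
      rw [Finset.mem_sdiff, Finset.mem_range] at hp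
      exact h p hp.1 hp.2)
  intro l hl
  rw [← Lagrange.eval_interpolate_at_node f hvk (Finset.mem_range.2 hl), heq,
    Lagrange.eval_interpolate_at_node g hvk (Finset.mem_range.2 hl)]

/-- Sliding-window form of `eq_of_rsCoord_eq`: the coordinates are sent at the times
`τ, τ + 1, …`, and those sent at times in `E` are lost. -/
lemma eq_of_rsCoord_eq_of_time_notMem {F : Type} [Field F] {v : ℕ → F} {k N : ℕ} {f g : ℕ → F}
    (hv : Set.InjOn v (Finset.range (k + N))) {E : Finset ℕ} (hE : E.card ≤ N) (τ : ℤ)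
    (hneg : ∀ p < k + N, τ + p < 0 → rsCoord v k f p = rsCoord v k g p)
    (h : ∀ p < k + N, ∀ u : ℕ, (u : ℤ) = τ + p → u ∉ E → rsCoord v k f p = rsCoord v k g p) :
    ∀ l < k, f l = g l := by
  refine eq_of_rsCoord_eq hv (B := (Finset.range (k + N)).filter
    fun p => 0 ≤ τ + p ∧ (τ + p).toNat ∈ E) ?_ ?_
  · refine (Finset.card_le_card_of_injOn (fun p : ℕ => (τ + p).toNat) ?_ ?_).trans hE
    · intro p hp
      exact (Finset.mem_filter.1 hp).2.2
    · intro p hp q hq hpq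
      have hp' := (Finset.mem_filter.1 hp).2.1
      have hq' := (Finset.mem_filter.1 hq).2.1
      simp only at hpq
      omega
  · intro p hp hpB
    rcases lt_or_ge (τ + p) 0 with h0 | h0
    · exact hneg p hp h0
    · refine h p hp (τ + p).toNat (Int.toNat_of_nonneg h0) fun hmem => hpB ?_
      exact Finset.mem_filter.2 ⟨Finset.mem_range.2 hp, h0, hmem⟩

lemma linkOut_eq_linkOut {α : Type*} {E E' : Finset ℕ} {x y : ℕ → α} {t : ℕ}
    (h : linkOut E x t = linkOut E' y t) (ht : t ∉ E) : x t = y t := by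
  by_cases ht' : t ∈ E'
  · simp [linkOut, ht, ht'] at h
  · simpa [linkOut, ht, ht'] using h

namespace SymbolwiseRelay

/-- Position in the source packet of the `l`-th symbol for the link pair `(i, j)`. -/
def symbolIndex {L1 L2 : ℕ} (k : Fin L1 → Fin L2 → ℕ) (i : Fin L1) (j : Fin L2)
    (l : Fin (k i j)) : Fin (∑ i, ∑ j, k i j) :=
  finSigmaFinEquiv ⟨i, finSigmaFinEquiv ⟨j, l⟩⟩

lemma exists_symbolIndex_eq {L1 L2 : ℕ} (k : Fin L1 → Fin L2 → ℕ)
    (q : Fin (∑ i, ∑ j, k i j)) : ∃ i j l, symbolIndex k i j l = q := by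
  obtain ⟨⟨i, r⟩, rfl⟩ := finSigmaFinEquiv.surjective q
  obtain ⟨⟨j, l⟩, rfl⟩ := finSigmaFinEquiv.surjective r
  exact ⟨i, j, l, rfl⟩

/-- The source symbols for the link pair `(i, j)`, extended by zero to negative times. -/
def signal {F : Type} [Field F] {L1 L2 : ℕ} (k : Fin L1 → Fin L2 → ℕ)
    (s : ℕ → Fin (∑ i, ∑ j, k i j) → F) (i : Fin L1) (j : Fin L2) (τ : ℤ) (l : ℕ) : F :=
  if h : l < k i j then if 0 ≤ τ then s τ.toNat (symbolIndex k i j ⟨l, h⟩) else 0 else 0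

lemma signal_of_neg {F : Type} [Field F] {L1 L2 : ℕ} (k : Fin L1 → Fin L2 → ℕ)
    (s : ℕ → Fin (∑ i, ∑ j, k i j) → F) (i : Fin L1) (j : Fin L2) {τ : ℤ} (hτ : τ < 0) (l : ℕ) :
    signal k s i j τ l = 0 := by
  simp [signal, hτ.not_ge]

lemma signal_natCast {F : Type} [Field F] {L1 L2 : ℕ} (k : Fin L1 → Fin L2 → ℕ)
    (s : ℕ → Fin (∑ i, ∑ j, k i j) → F) (i : Fin L1) (j : Fin L2) (t : ℕ) (l : Fin (k i j)) :
    signal k s i j t l = s t (symbolIndex k i j l) := by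
  simp [signal]

lemma signal_congr {F : Type} [Field F] {L1 L2 : ℕ} (k : Fin L1 → Fin L2 → ℕ)
    {s s' : ℕ → Fin (∑ i, ∑ j, k i j) → F} {t : ℕ} (h : ∀ u ≤ t, s u = s' u)
    (i : Fin L1) (j : Fin L2) {τ : ℤ} (hτ : τ ≤ t) (l : ℕ) :
    signal k s i j τ l = signal k s' i j τ l := by
  simp only [signal]
  rw [h τ.toNat (by omega)]

/-- First-hop packets: for every `j`, diagonally interleaved Reed–Solomon codewords. -/
noncomputable def sourcePacket {F : Type} [Field F] {L1 L2 : ℕ} (v : ℕ → F)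
    (k : Fin L1 → Fin L2 → ℕ) (m1 : Fin L2 → ℕ) (s : ℕ → Fin (∑ i, ∑ j, k i j) → F)
    (t : ℕ) (i : Fin L1) (q : Fin (∑ j, m1 j)) : F :=
  let jp := finSigmaFinEquiv.symm q
  rsCoord v (k i jp.1) (fun l => signal k s i jp.1 (t - jp.2 + l) l) jp.2

/-- Second-hop packets: for every `i`, Reed–Solomon codewords of the source symbols delayed by
`N1 i`, in reverse order because symbols with larger index are available earlier. -/
noncomputable def relayPacket {F : Type} [Field F] {L1 L2 : ℕ} (v : ℕ → F)
    (k : Fin L1 → Fin L2 → ℕ) (N1 m2 : Fin L1 → ℕ) (s : ℕ → Fin (∑ i, ∑ j, k i j) → F)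
    (t : ℕ) (j : Fin L2) (q : Fin (∑ i, m2 i)) : F :=
  let ip := finSigmaFinEquiv.symm q
  rsCoord v (k ip.1 j) (fun m => signal k s ip.1 j (t - ip.2 - N1 ip.1) (k ip.1 j - 1 - m)) ip.2

lemma sourcePacket_apply {F : Type} [Field F] {L1 L2 : ℕ} (v : ℕ → F)
    (k : Fin L1 → Fin L2 → ℕ) (m1 : Fin L2 → ℕ) (s : ℕ → Fin (∑ i, ∑ j, k i j) → F)
    (t : ℕ) (i : Fin L1) (j : Fin L2) (p : Fin (m1 j)) :
    sourcePacket v k m1 s t i (finSigmaFinEquiv ⟨j, p⟩) =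
      rsCoord v (k i j) (fun l => signal k s i j (t - p + l) l) p := by
  unfold sourcePacket
  rw [Equiv.symm_apply_apply]

lemma relayPacket_apply {F : Type} [Field F] {L1 L2 : ℕ} (v : ℕ → F)
    (k : Fin L1 → Fin L2 → ℕ) (N1 m2 : Fin L1 → ℕ) (s : ℕ → Fin (∑ i, ∑ j, k i j) → F)
    (t : ℕ) (j : Fin L2) (i : Fin L1) (p : Fin (m2 i)) :
    relayPacket v k N1 m2 s t j (finSigmaFinEquiv ⟨i, p⟩) =
      rsCoord v (k i j) (fun m => signal k s i j (t - p - N1 i) (k i j - 1 - m)) p := by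
  unfold relayPacket
  rw [Equiv.symm_apply_apply]

lemma sourcePacket_congr {F : Type} [Field F] {L1 L2 : ℕ} {v : ℕ → F}
    {k : Fin L1 → Fin L2 → ℕ} (m1 : Fin L2 → ℕ)
    (hv : ∀ i j, Set.InjOn v (Finset.range (k i j)))
    {s s' : ℕ → Fin (∑ i, ∑ j, k i j) → F} {t : ℕ} (h : ∀ u ≤ t, s u = s' u) (i : Fin L1) :
    sourcePacket v k m1 s t i = sourcePacket v k m1 s' t i := by
  funext q
  obtain ⟨⟨j, p⟩, rfl⟩ := finSigmaFinEquiv.surjective q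
  rw [sourcePacket_apply, sourcePacket_apply]
  exact rsCoord_congr (hv i j) fun l _ hlp => signal_congr k h i j (by omega) l

/-- The relay recovers symbol `l` of pair `(i, j)` with delay `k i j + N1 i - 1 - l`. -/
lemma signal_eq_of_linkOut_sourcePacket_eq {F : Type} [Field F] {L1 L2 : ℕ} {v : ℕ → F}
    {k : Fin L1 → Fin L2 → ℕ} {N1 : Fin L1 → ℕ} {m1 : Fin L2 → ℕ}
    (hv : ∀ i j, Set.InjOn v (Finset.range (k i j)))
    {s s' : ℕ → Fin (∑ i, ∑ j, k i j) → F} {i : Fin L1} {j : Fin L2}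
    (hv' : Set.InjOn v (Finset.range (k i j + N1 i))) (hm : k i j + N1 i ≤ m1 j)
    {E E' : Finset ℕ} (hE : E.card ≤ N1 i) {t : ℕ}
    (h : ∀ u ≤ t, linkOut E (fun w => sourcePacket v k m1 s w i) u =
      linkOut E' (fun w => sourcePacket v k m1 s' w i) u)
    {σ : ℤ} {l : ℕ} (hl : l < k i j) (hσ : σ - l + (k i j + N1 i) ≤ t + 1) :
    signal k s i j σ l = signal k s' i j σ l := by
  have key := eq_of_rsCoord_eq_of_time_notMem
    (f := fun m : ℕ => signal k s i j (σ - l + m) m)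
    (g := fun m : ℕ => signal k s' i j (σ - l + m) m) hv' hE (σ - l) ?_ ?_ l hl
  · simpa using key
  · intro p _ hneg
    refine rsCoord_congr (hv i j) fun m _ hmp => ?_
    rw [signal_of_neg _ _ _ _ (by omega), signal_of_neg _ _ _ _ (by omega)]
  · intro p hp u hu huE
    have hpk := congrFun (linkOut_eq_linkOut (h u (by omega)) huE)
      (finSigmaFinEquiv ⟨j, ⟨p, hp.trans_le hm⟩⟩)
    rw [sourcePacket_apply, sourcePacket_apply] at hpk
    have hup : (u : ℤ) - p = σ - l := by omega
    simpa only [hup] using hpk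

/-- The first-hop outputs up to time `t` determine the second-hop packets at time `t`. -/
lemma relayPacket_eq_of_linkOut_sourcePacket_eq {F : Type} [Field F] {L1 L2 : ℕ} {v : ℕ → F}
    {k : Fin L1 → Fin L2 → ℕ} {N1 m2 : Fin L1 → ℕ} {m1 : Fin L2 → ℕ}
    (hv : ∀ i j, Set.InjOn v (Finset.range (k i j)))
    (hv' : ∀ i j, 0 < k i j → Set.InjOn v (Finset.range (k i j + N1 i)))
    (hm : ∀ i j, 0 < k i j → k i j + N1 i ≤ m1 j)
    {s s' : ℕ → Fin (∑ i, ∑ j, k i j) → F} {E E' : Fin L1 → Finset ℕ}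
    (hE : ∀ i, (E i).card = N1 i) {t : ℕ}
    (h : ∀ u ≤ t, ∀ i, linkOut (E i) (fun w => sourcePacket v k m1 s w i) u =
      linkOut (E' i) (fun w => sourcePacket v k m1 s' w i) u) (j : Fin L2) :
    relayPacket v k N1 m2 s t j = relayPacket v k N1 m2 s' t j := by
  funext q
  obtain ⟨⟨i, p⟩, rfl⟩ := finSigmaFinEquiv.surjective q
  rw [relayPacket_apply, relayPacket_apply]
  refine rsCoord_congr (hv i j) fun m hmk hmp => ?_
  have hk : 0 < k i j := by omega
  exact signal_eq_of_linkOut_sourcePacket_eq hv (hv' i j hk) (hm i j hk) (hE i).le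
    (fun u hu => h u hu i) (by omega) (by omega)

/-- The second-hop outputs up to time `t + T` determine the source packet at time `t`. -/
lemma eq_of_linkOut_relayPacket_eq {F : Type} [Field F] {L1 L2 : ℕ} {v : ℕ → F}
    {k : Fin L1 → Fin L2 → ℕ} {N1 m2 : Fin L1 → ℕ} {N2 : Fin L2 → ℕ} {T : ℕ}
    (hv : ∀ i j, 0 < k i j → Set.InjOn v (Finset.range (k i j + N2 j)))
    (hm : ∀ i j, 0 < k i j → k i j + N2 j ≤ m2 i)
    (hT : ∀ i j, 0 < k i j → k i j + N2 j + N1 i ≤ T + 1)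
    {s s' : ℕ → Fin (∑ i, ∑ j, k i j) → F} {E E' : Fin L2 → Finset ℕ}
    (hE : ∀ j, (E j).card = N2 j) {t : ℕ}
    (h : ∀ u ≤ t + T, ∀ j, linkOut (E j) (fun w => relayPacket v k N1 m2 s w j) u =
      linkOut (E' j) (fun w => relayPacket v k N1 m2 s' w j) u) :
    s t = s' t := by
  funext q
  obtain ⟨i, j, l, rfl⟩ := exists_symbolIndex_eq k q
  have hk : 0 < k i j := l.pos
  have hT' := hT i j hk
  have key := eq_of_rsCoord_eq_of_time_notMem
    (f := fun m : ℕ => signal k s i j t (k i j - 1 - m))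
    (g := fun m : ℕ => signal k s' i j t (k i j - 1 - m)) (hv i j hk) (hE j).le (t + N1 i)
    (fun p _ hneg => by omega) ?_ (k i j - 1 - l) (by omega)
  · simp only [show k i j - 1 - (k i j - 1 - l) = (l : ℕ) by omega] at key
    rwa [signal_natCast, signal_natCast] at key
  · intro p hp u hu huE
    have hpk := congrFun (linkOut_eq_linkOut (h u (by omega) j) huE)
      (finSigmaFinEquiv ⟨i, ⟨p, hp.trans_le (hm i j hk)⟩⟩)
    rw [relayPacket_apply, relayPacket_apply] at hpk
    have hup : (u : ℤ) - p - N1 i = t := by omega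
    simpa only [hup] using hpk

end SymbolwiseRelay

/-- If a value is determined by an observation, it can be computed from it. -/
lemma exists_decoder {ι α β : Type*} [Nonempty β] {P : ι → Prop} {obs : ι → α} {val : ι → β}
    (h : ∀ a b, P a → P b → obs a = obs b → val a = val b) :
    ∃ d : α → β, ∀ a, P a → d (obs a) = val a := by
  classical
  refine ⟨fun o => if ho : ∃ a, P a ∧ obs a = o then val ho.choose
    else Classical.arbitrary β, fun a ha => ?_⟩
  have ho : ∃ b, P b ∧ obs b = obs a := ⟨a, ha, rfl⟩
  simp only [dif_pos ho]
  exact h _ _ ho.choose_spec.1 ha ho.choose_spec.2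

open SymbolwiseRelay in
/-- A relay code exists whenever Reed–Solomon codes correcting the erasures of both hops fit
into the packets and into the deadline. -/
lemma exists_achievable_relayCode {F : Type} [Field F] {L1 L2 T : ℕ} {v : ℕ → F}
    {k : Fin L1 → Fin L2 → ℕ} {N1 m2 : Fin L1 → ℕ} {N2 m1 : Fin L2 → ℕ}
    (hv : Set.InjOn v (Finset.range (T + 1)))
    (hm1 : ∀ i j, 0 < k i j → k i j + N1 i ≤ m1 j)
    (hm2 : ∀ i j, 0 < k i j → k i j + N2 j ≤ m2 i)
    (hT : ∀ i j, 0 < k i j → k i j + N2 j + N1 i ≤ T + 1) :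
    ∃ c : RelayCode F L1 L2 (∑ i, ∑ j, k i j) (fun _ => ∑ j, m1 j) (fun _ => ∑ i, m2 i),
      c.Achievable N1 N2 T := by
  have hvn {n : ℕ} (hn : n ≤ T + 1) : Set.InjOn v (Finset.range n) :=
    hv.mono (Finset.coe_subset.2 (Finset.range_subset_range.2 hn))
  have hvk (i : Fin L1) (j : Fin L2) : Set.InjOn v (Finset.range (k i j)) := by
    refine hvn ?_
    rcases Nat.eq_zero_or_pos (k i j) with h | h
    · omega
    · have := hT i j h
      omega
  have hrel (t : ℕ) (j : Fin L2) := exists_decoder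
    (P := fun a : (ℕ → Fin (∑ i, ∑ j, k i j) → F) × (Fin L1 → Finset ℕ) =>
      ∀ i, (a.2 i).card = N1 i)
    (obs := fun a (u : Fin (t + 1)) i =>
      linkOut (a.2 i) (fun w => sourcePacket v k m1 a.1 w i) u)
    (val := fun a => relayPacket v k N1 m2 a.1 t j) (by
      intro a b ha _ hab
      refine relayPacket_eq_of_linkOut_sourcePacket_eq hvk
        (fun i j hk => hvn (by have := hT i j hk; omega)) hm1 ha (E' := b.2) ?_ j
      intro u hu i
      exact congrFun (congrFun hab ⟨u, Nat.lt_succ_of_le hu⟩) i)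
  choose rel hrel using hrel
  let c : RelayCode F L1 L2 (∑ i, ∑ j, k i j) (fun _ => ∑ j, m1 j) (fun _ => ∑ i, m2 i) :=
    { srcEnc := fun t i h =>
        sourcePacket v k m1 (fun u => if hu : u < t + 1 then h ⟨u, hu⟩ else 0) t i
      relEnc := rel }
  have hx1 : ∀ s t i, c.x1 s t i = sourcePacket v k m1 s t i := by
    intro s t i
    refine sourcePacket_congr m1 hvk (fun u hu => ?_) i
    rw [dif_pos (Nat.lt_succ_of_le hu)]
  have hx2 : ∀ s E1, (∀ i, (E1 i).card = N1 i) → ∀ t j,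
      c.x2 s E1 t j = relayPacket v k N1 m2 s t j := by
    intro s E1 hE1 t j
    simp only [RelayCode.x2, hx1]
    exact hrel t j (s, E1) hE1
  have hdec (t : ℕ) := exists_decoder
    (P := fun a : (ℕ → Fin (∑ i, ∑ j, k i j) → F) × (Fin L2 → Finset ℕ) =>
      ∀ j, (a.2 j).card = N2 j)
    (obs := fun a (u : Fin (t + T + 1)) j =>
      linkOut (a.2 j) (fun w => relayPacket v k N1 m2 a.1 w j) u)
    (val := fun a => a.1 t) (by
      intro a b ha _ hab
      refine eq_of_linkOut_relayPacket_eq (N1 := N1)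
        (fun i j hk => hvn (by have := hT i j hk; omega)) hm2 hT ha (E' := b.2) ?_
      intro u hu j
      exact congrFun (congrFun hab ⟨u, Nat.lt_succ_of_le hu⟩) j)
  choose dec hdec using hdec
  refine ⟨c, dec, fun s E1 E2 hE1 hE2 t => ?_⟩
  simp only [hx2 s E1 hE1]
  exact hdec t (s, E2) hE2

lemma exists_field_injOn_range (n : ℕ) :
    ∃ (F : Type) (_ : Field F) (_ : Fintype F) (v : ℕ → F), Set.InjOn v (Finset.range n) := by
  obtain ⟨p, hnp, hp⟩ := Nat.exists_infinite_primes n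
  have : Fact p.Prime := ⟨hp⟩
  refine ⟨ZMod p, inferInstance, inferInstance, Nat.cast, fun a ha b hb hab => ?_⟩
  rw [Finset.coe_range, Set.mem_Iio] at ha hb
  exact Nat.ModEq.eq_of_lt_of_lt ((ZMod.natCast_eq_natCast_iff a b p).1 hab) (by omega) (by omega)

lemma natCast_sub_sub_eq_max (a b c : ℕ) (h : b ≤ a) :
    ((a - b - c : ℕ) : ℝ) = max ((a : ℝ) - b - c) 0 := by
  rcases le_total c (a - b) with hc | hc
  · rw [Nat.cast_sub hc, Nat.cast_sub h, max_eq_left]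
    rw [← Nat.cast_sub h, sub_nonneg]
    exact_mod_cast hc
  · rw [Nat.sub_eq_zero_of_le hc, Nat.cast_zero, max_eq_right]
    rw [← Nat.cast_sub h, sub_nonpos]
    exact_mod_cast hc

/-- **achievability of the concatenated symbol-wise decode-and-forward
scheme.** For a positive deadline `T` and positive erasure numbers with `N1 i < T + 1`
and `N2 j < T + 1` on all links, over some (sufficiently large) finite field there is an
`(n1, n2, k, T)` streaming code for the three-node relay network that is
`(N1, N2)`-achievable with `k = Σ_{i,j} (T + 1 − N1 i − N2 j)⁺` (natural subtraction is
the positive part), `n1 i = Σ_j (T + 1 − N2 j)` on every first-hop link and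
`n2 j = Σ_i (T + 1 − N1 i)` on every second-hop link; in particular its rate equals
`Σ_{i,j} (T + 1 − N1 i − N2 j)⁺ / max(Σ_j (T + 1 − N2 j), Σ_i (T + 1 − N1 i))`. -/
theorem stmt16 (L1 L2 : ℕ) (hL1 : 1 ≤ L1) (hL2 : 1 ≤ L2) (T : ℕ) (hT : 0 < T)
    (N1 : Fin L1 → ℕ) (N2 : Fin L2 → ℕ)
    (hN1 : ∀ i, 0 < N1 i) (hN2 : ∀ j, 0 < N2 j)
    (h1 : ∀ i, N1 i < T + 1) (h2 : ∀ j, N2 j < T + 1) :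
    ∃ (F : Type) (_ : Field F) (_ : Fintype F)
      (c : RelayCode F L1 L2 (∑ i, ∑ j, (T + 1 - N1 i - N2 j))
        (fun _ : Fin L1 => ∑ j, (T + 1 - N2 j)) (fun _ : Fin L2 => ∑ i, (T + 1 - N1 i))),
      c.Achievable N1 N2 T ∧
      ((∑ i, ∑ j, (T + 1 - N1 i - N2 j) : ℕ) : ℝ) /
          ((max (Finset.univ.sup' (⟨⟨0, hL1⟩, Finset.mem_univ _⟩ :
              (Finset.univ : Finset (Fin L1)).Nonempty)
              (fun _ : Fin L1 => ∑ j, (T + 1 - N2 j)))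
            (Finset.univ.sup' (⟨⟨0, hL2⟩, Finset.mem_univ _⟩ :
              (Finset.univ : Finset (Fin L2)).Nonempty)
              (fun _ : Fin L2 => ∑ i, (T + 1 - N1 i))) : ℕ) : ℝ) =
        (∑ i, ∑ j, max ((T : ℝ) + 1 - N1 i - N2 j) 0) /
          max (∑ j, ((T : ℝ) + 1 - N2 j)) (∑ i, ((T : ℝ) + 1 - N1 i)) := by
  obtain ⟨F, hF, hF', v, hv⟩ := exists_field_injOn_range (T + 1)
  obtain ⟨c, hc⟩ := exists_achievable_relayCode (L1 := L1) (L2 := L2) (T := T) (N1 := N1)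
    (N2 := N2) (k := fun i j => T + 1 - N1 i - N2 j) (m1 := fun j => T + 1 - N2 j)
    (m2 := fun i => T + 1 - N1 i) hv (fun i j _ => by omega) (fun i j _ => by omega)
    (fun i j _ => by omega)
  refine ⟨F, hF, hF', c, hc, ?_⟩
  have hsub (a : ℕ) (ha : a < T + 1) : ((T + 1 - a : ℕ) : ℝ) = (T : ℝ) + 1 - a := by
    rw [Nat.cast_sub ha.le, Nat.cast_succ]
  have hpos (i : Fin L1) (j : Fin L2) :
      ((T + 1 - N1 i - N2 j : ℕ) : ℝ) = max ((T : ℝ) + 1 - N1 i - N2 j) 0 := by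
    rw [natCast_sub_sub_eq_max _ _ _ (h1 i).le, Nat.cast_succ]
  generalize_proofs H1 H2
  rw [Finset.sup'_const, Finset.sup'_const]
  simp only [Nat.cast_max, Nat.cast_sum, hpos, fun i => hsub _ (h1 i),
    fun j => hsub _ (h2 j)]
end
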